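/- Let F : ℕ → ℝ be given by F(k) = k². Then for every r ∈ ℝ with |r| < π/2, the series ∑_{j=0}^{∞} (−1)^j · Δ_F(1, j) · r^{2j}/(2j)! converges (HasSum) with sum 1/cosh r. -/

import Mathlib

/-- `Delta F m j` is the quantity `Δ_F(m, j)` defined by `Δ_F(m, 0) = 1` and
`Δ_F(m, j) = ∑_{k=1}^{m} F(k) · Δ_F(k+1, j−1)` for `j ≥ 1`. -/
noncomputable def Delta (F : ℕ → ℝ) : ℕ → ℕ → ℝ
  | _, 0 => 1
  | m, j + 1 => ∑ k ∈ Finset.Icc 1 m, F k * Delta F (k + 1) j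
  termination_by m j => j

theorem Delta_zero (F : ℕ → ℝ) (m : ℕ) : Delta F m 0 = 1 := by
  simp [Delta]

theorem Delta_zero_left (F : ℕ → ℝ) (j : ℕ) : Delta F 0 (j + 1) = 0 := by
  simp [Delta]

theorem Delta_succ_succ (F : ℕ → ℝ) (m j : ℕ) :
    Delta F (m + 1) (j + 1) = Delta F m (j + 1) + F (m + 1) * Delta F (m + 2) j := by
  rw [Delta, Delta, Finset.sum_Icc_succ_top (by omega)]

/-- The function `sinh ^ h / cosh ^ (h + 1)`, that is, `sech * tanh ^ h`. -/
noncomputable def sechTanhPow (h : ℕ) (z : ℂ) : ℂ :=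
  Complex.sinh z ^ h / Complex.cosh z ^ (h + 1)

theorem Complex.cosh_ne_zero_of_norm_lt {z : ℂ} (hz : ‖z‖ < Real.pi / 2) :
    Complex.cosh z ≠ 0 := by
  rw [← Complex.cos_mul_I, Ne, Complex.cos_eq_zero_iff]
  rintro ⟨k, hk⟩
  have hnorm : ‖z‖ = |(2 * k + 1 : ℝ)| * Real.pi / 2 := by
    have h := congrArg norm hk
    rw [norm_mul, Complex.norm_I, mul_one] at h
    rw [h, show ((2 * k + 1) * Real.pi / 2 : ℂ) = (((2 * k + 1) * Real.pi / 2 : ℝ) : ℂ) by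
      push_cast; ring, Complex.norm_real, Real.norm_eq_abs, abs_div, abs_mul,
      abs_of_pos Real.pi_pos, abs_two]
  have hk1 : (1 : ℝ) ≤ |(2 * k + 1 : ℝ)| := by
    have : (1 : ℤ) ≤ |2 * k + 1| := Int.one_le_abs (by omega)
    exact_mod_cast this
  nlinarith [Real.pi_pos]

theorem hasDerivAt_sechTanhPow (h : ℕ) {z : ℂ} (hz : Complex.cosh z ≠ 0) :
    HasDerivAt (sechTanhPow h)
      (h * sechTanhPow (h - 1) z - (h + 1) * sechTanhPow (h + 1) z) z := by
  have hd := ((Complex.hasDerivAt_sinh z).pow h).div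
    ((Complex.hasDerivAt_cosh z).pow (h + 1)) (pow_ne_zero _ hz)
  refine hd.congr_deriv ?_
  cases h with
  | zero => simp [sechTanhPow]; field_simp
  | succ h =>
    simp only [sechTanhPow, Nat.add_sub_cancel, Pi.pow_apply]
    push_cast
    field_simp
    ring

theorem contDiffAt_sechTanhPow (h : ℕ) {n : WithTop ℕ∞} {z : ℂ} (hz : Complex.cosh z ≠ 0) :
    ContDiffAt ℂ n (sechTanhPow h) z :=
  (Complex.contDiff_sinh.contDiffAt.pow h).div (Complex.contDiff_cosh.contDiffAt.pow (h + 1))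
    (pow_ne_zero _ hz)

theorem iteratedDeriv_succ_sechTanhPow (n h : ℕ) {z : ℂ} (hz : Complex.cosh z ≠ 0) :
    iteratedDeriv (n + 1) (sechTanhPow h) z =
      h * iteratedDeriv n (sechTanhPow (h - 1)) z
        - (h + 1) * iteratedDeriv n (sechTanhPow (h + 1)) z := by
  have hev : deriv (sechTanhPow h) =ᶠ[nhds z]
      (fun w => (h : ℂ) * sechTanhPow (h - 1) w) -
        fun w => ((h : ℂ) + 1) * sechTanhPow (h + 1) w := by
    filter_upwards [Complex.continuous_cosh.continuousAt.eventually_ne hz] with w hw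
    exact (hasDerivAt_sechTanhPow h hw).deriv
  rw [iteratedDeriv_succ', hev.iteratedDeriv_eq, iteratedDeriv_sub
    (contDiffAt_const.mul (contDiffAt_sechTanhPow _ hz))
    (contDiffAt_const.mul (contDiffAt_sechTanhPow _ hz)),
    iteratedDeriv_const_mul_field, iteratedDeriv_const_mul_field]

theorem iteratedDeriv_sechTanhPow_zero_of_lt {n h : ℕ} (hnh : n < h) :
    iteratedDeriv n (sechTanhPow h) 0 = 0 := by
  induction n generalizing h with
  | zero => simp [sechTanhPow, (Nat.ne_of_gt hnh)]
  | succ n ih =>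
    rw [iteratedDeriv_succ_sechTanhPow n h (by simp), ih (by omega), ih (by omega)]
    simp

theorem iteratedDeriv_sechTanhPow_zero_of_odd {n h : ℕ} (hnh : Odd (n + h)) :
    iteratedDeriv n (sechTanhPow h) 0 = 0 := by
  induction n generalizing h with
  | zero =>
    have : h ≠ 0 := by rintro rfl; simp at hnh
    simp [sechTanhPow, this]
  | succ n ih =>
    rw [iteratedDeriv_succ_sechTanhPow n h (by simp), ih (h := h + 1) (by grind)]
    rcases h with _ | h
    · simp
    · rw [Nat.add_sub_cancel, ih (by grind)]
      simp

theorem iteratedDeriv_sechTanhPow_zero (j h : ℕ) :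
    iteratedDeriv (2 * j + h) (sechTanhPow h) 0 =
      (-1) ^ j * (h.factorial : ℂ) * (Delta (fun k => (k : ℝ) ^ 2) (h + 1) j : ℂ) := by
  induction j generalizing h with
  | zero =>
    induction h with
    | zero => simp [sechTanhPow, Delta_zero]
    | succ h ih =>
      simp only [Delta_zero] at ih ⊢
      rw [← add_assoc, iteratedDeriv_succ_sechTanhPow _ _ (by simp), Nat.add_sub_cancel, ih,
        iteratedDeriv_sechTanhPow_zero_of_lt (by omega), Nat.factorial_succ]
      push_cast
      ring
  | succ j ihj =>
    induction h with
    | zero =>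
      rw [show 2 * (j + 1) + 0 = (2 * j + (0 + 1)) + 1 by ring,
        iteratedDeriv_succ_sechTanhPow _ _ (by simp), ihj, Delta_succ_succ, Delta_zero_left]
      push_cast
      simp [pow_succ]
    | succ h ih =>
      rw [← add_assoc, iteratedDeriv_succ_sechTanhPow _ _ (by simp), Nat.add_sub_cancel, ih,
        show 2 * (j + 1) + h = 2 * j + (h + 1 + 1) by ring, ihj, Delta_succ_succ _ (h + 1)]
      simp only [Nat.factorial_succ]
      push_cast
      ring

/-- For `F(k) = k²` and `|r| < π/2`, the series `∑_j (−1)^j Δ_F(1, j) r^{2j}/(2j)!`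
converges with sum `1/cosh r`. -/
theorem euler_series (r : ℝ) (hr : |r| < Real.pi / 2) :
    HasSum
      (fun j : ℕ =>
        (-1 : ℝ) ^ j * Delta (fun k => (k : ℝ) ^ 2) 1 j * r ^ (2 * j) /
          (Nat.factorial (2 * j) : ℝ))
      (1 / Real.cosh r) := by
  have hdiff : DifferentiableOn ℂ (sechTanhPow 0) (Metric.ball 0 (Real.pi / 2)) := fun z hz =>
    (hasDerivAt_sechTanhPow 0 (Complex.cosh_ne_zero_of_norm_lt
      (by simpa using hz))).differentiableAt.differentiableWithinAt
  have hsum := Complex.hasSum_taylorSeries_on_ball hdiff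
    (z := (r : ℂ)) (by simpa using hr)
  rw [← Function.Injective.hasSum_iff (mul_right_injective₀ (two_ne_zero' ℕ))] at hsum
  · have hval : sechTanhPow 0 r = ((1 / Real.cosh r : ℝ) : ℂ) := by
      simp [sechTanhPow]
    rw [hval] at hsum
    refine Complex.hasSum_ofReal.mp (hsum.congr_fun fun j => ?_)
    have h := iteratedDeriv_sechTanhPow_zero j 0
    simp only [add_zero, zero_add, Nat.factorial_zero, Nat.cast_one, mul_one] at h
    simp only [Function.comp_apply, h, sub_zero, smul_eq_mul]
    push_cast
    ring
  · intro n hn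
    have hodd : Odd (n + 0) := by
      rw [add_zero, ← Nat.not_even_iff_odd]
      rintro ⟨k, rfl⟩
      exact hn ⟨k, two_mul k⟩
    simp [iteratedDeriv_sechTanhPow_zero_of_odd hodd]
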